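/- For every vertex w of H with deg_H(w) ≤ k-1, we have Σ_{s ∈ sh_H(w), deg_H(s) ≤ k-1} (k - deg_H(s)) ≤ (k-1)·|sh_H(w)| - ē_H(sh_H(w)) + 1, where the sum ranges over all vertices s of the shadow sh_H(w) with deg_H(s) ≤ k-1. -/

import Mathlib

/-- The number of edges of `H` incident with at least one vertex of `X`. -/
def eBar {V : Type*} [Fintype V] [DecidableEq V] (H : SimpleGraph V) [DecidableRel H.Adj]
    (X : Finset V) : ℕ :=
  (H.edgeFinset.filter (fun e => ∃ v ∈ X, v ∈ e)).card

/-- A subset `Y ⊆ V(H)` is `w`-closed (with respect to the collection `CH`) if: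
(I) `w ∈ Y`; (II) every `D ∈ CH` satisfies `D ⊆ Y` or `D ∩ Y = ∅`; (III) every vertex
outside `Y` adjacent to a vertex of `Y` has degree at least `k` in `H - Y`; (IV) every
`D ∈ CH` adjacent to a vertex of `Y` satisfies `D ⊆ Y`. -/
def WClosed {V : Type*} [Fintype V] [DecidableEq V] (k : ℕ) (H : SimpleGraph V)
    [DecidableRel H.Adj] (CH : Finset (Finset V)) (w : V) (Y : Finset V) : Prop :=
  w ∈ Y ∧
  (∀ D ∈ CH, D ⊆ Y ∨ D ∩ Y = ∅) ∧
  (∀ v ∉ Y, (∃ y ∈ Y, H.Adj v y) → k ≤ (H.neighborFinset v \ Y).card) ∧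
  (∀ D ∈ CH, (∃ d ∈ D, ∃ y ∈ Y, H.Adj d y) → D ⊆ Y)

theorem eBar_insert_le {V : Type*} [Fintype V] [DecidableEq V] (H : SimpleGraph V)
    [DecidableRel H.Adj] (Y : Finset V) (v : V) :
    eBar H (insert v Y) ≤ eBar H Y + (H.neighborFinset v \ Y).card := by
  unfold eBar
  refine le_trans (Finset.card_le_card (t := (H.edgeFinset.filter (fun e => ∃ v ∈ Y, v ∈ e)) ∪
    (H.neighborFinset v \ Y).image (fun u => s(v, u))) ?_) ?_
  · intro e he
    rw [Finset.mem_filter] at he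
    obtain ⟨he, x, hx, hxe⟩ := he
    rw [Finset.mem_union]
    by_cases h : ∃ y ∈ Y, y ∈ e
    · left
      exact Finset.mem_filter.2 ⟨he, h⟩
    · right
      rcases Finset.mem_insert.1 hx with rfl | hx
      · obtain ⟨u, rfl⟩ := Sym2.mem_iff_exists.1 hxe
        rw [SimpleGraph.mem_edgeFinset, SimpleGraph.mem_edgeSet] at he
        refine Finset.mem_image.2 ⟨u, ?_, rfl⟩
        rw [Finset.mem_sdiff, SimpleGraph.mem_neighborFinset]
        exact ⟨he, fun hu => h ⟨u, hu, Sym2.mem_mk_right _ _⟩⟩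
      · exact absurd ⟨x, hx, hxe⟩ h
  · exact (Finset.card_union_le _ _).trans (Nat.add_le_add_left Finset.card_image_le _)

theorem eBar_union_lt {V : Type*} [Fintype V] [DecidableEq V] (H : SimpleGraph V)
    [DecidableRel H.Adj] (Y D : Finset V) (h : ∃ d ∈ D, ∃ y ∈ Y, H.Adj d y) :
    eBar H (Y ∪ D) + 1 ≤ eBar H Y + eBar H D := by
  obtain ⟨d, hd, y, hy, hdy⟩ := h
  unfold eBar
  rw [← Finset.card_union_add_card_inter]
  apply Nat.add_le_add
  · apply Finset.card_le_card
    intro e he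
    rw [Finset.mem_filter] at he
    obtain ⟨he, x, hx, hxe⟩ := he
    rw [Finset.mem_union, Finset.mem_filter, Finset.mem_filter]
    rcases Finset.mem_union.1 hx with hx | hx
    · exact Or.inl ⟨he, x, hx, hxe⟩
    · exact Or.inr ⟨he, x, hx, hxe⟩
  · rw [Nat.succ_le_iff, Finset.card_pos]
    refine ⟨s(d, y), ?_⟩
    have : s(d, y) ∈ H.edgeFinset := by simpa using hdy
    rw [Finset.mem_inter, Finset.mem_filter, Finset.mem_filter]
    exact ⟨⟨this, y, hy, Sym2.mem_mk_right _ _⟩, this, d, hd, Sym2.mem_mk_left _ _⟩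

/-- The low-degree vertices of the shadow `sh_H(w)` satisfy
`Σ_{s ∈ sh_H(w), deg_H(s) ≤ k-1} (k - deg_H(s)) ≤ (k-1)·|sh_H(w)| - ē_H(sh_H(w)) + 1`. -/
theorem sum_deg_deficiency_shadow_le {V : Type*} [Fintype V] [DecidableEq V]
    (k : ℕ) (hk : 2 ≤ k) (H : SimpleGraph V) [DecidableRel H.Adj]
    (CH : Finset (Finset V))
    (hCHne : ∀ D ∈ CH, D.Nonempty)
    (hCHdisj : ∀ D₁ ∈ CH, ∀ D₂ ∈ CH, D₁ ≠ D₂ → Disjoint D₁ D₂)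
    (hCHe : ∀ D ∈ CH, eBar H D ≤ (k - 1) * D.card + 1)
    (hCHdeg : ∀ D ∈ CH, ∀ v ∈ D, k ≤ H.degree v)
    (w : V) (hw : H.degree w ≤ k - 1)
    (Sh : Finset V) (hSh : WClosed k H CH w Sh)
    (hShMin : ∀ Y : Finset V, WClosed k H CH w Y → Sh ⊆ Y) :
    ∑ s ∈ Sh.filter (fun s => H.degree s ≤ k - 1), ((k : ℤ) - (H.degree s : ℤ))
      ≤ ((k : ℤ) - 1) * (Sh.card : ℤ) - (eBar H Sh : ℤ) + 1 := by
  classical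
  obtain ⟨hwS, hII, hIII, hIV⟩ := hSh
  let P : Finset V → Prop := fun Y => w ∈ Y ∧ (∀ D ∈ CH, D ⊆ Y ∨ D ∩ Y = ∅) ∧
    ∑ s ∈ Y.filter (fun s => H.degree s ≤ k - 1), ((k : ℤ) - (H.degree s : ℤ))
      ≤ ((k : ℤ) - 1) * (Y.card : ℤ) - (eBar H Y : ℤ) + 1
  have hwD : ∀ D ∈ CH, w ∉ D := by
    intro D hD hwD
    have := hCHdeg D hD w hwD
    omega
  have hP0 : P {w} := by
    refine ⟨Finset.mem_singleton_self w, ?_, ?_⟩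
    · intro D hD
      right
      rw [← Finset.disjoint_iff_inter_eq_empty]
      exact Finset.disjoint_singleton_right.2 (hwD D hD)
    · have h1 := eBar_insert_le H ∅ w
      have h0 : eBar H (∅ : Finset V) = 0 := by simp [eBar]
      rw [h0, Finset.sdiff_empty, SimpleGraph.card_neighborFinset_eq_degree,
        insert_empty_eq] at h1
      rw [Finset.filter_singleton, if_pos hw, Finset.sum_singleton, Finset.card_singleton]
      push_cast
      omega
  obtain ⟨Y, hYmem, hYmax⟩ := Finset.exists_max_image (Sh.powerset.filter P) Finset.card
    ⟨{w}, Finset.mem_filter.2 ⟨Finset.mem_powerset.2 (Finset.singleton_subset_iff.2 hwS), hP0⟩⟩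
  rw [Finset.mem_filter, Finset.mem_powerset] at hYmem
  obtain ⟨hYS, hwY, hYII, hYle⟩ := hYmem
  have hmax : ∀ Z, Z ⊆ Sh → P Z → Z.card ≤ Y.card := fun Z h1 h2 =>
    hYmax Z (Finset.mem_filter.2 ⟨Finset.mem_powerset.2 h1, h2⟩)
  have hYIV : ∀ D ∈ CH, (∃ d ∈ D, ∃ y ∈ Y, H.Adj d y) → D ⊆ Y := by
    intro D hD hadj
    rcases hYII D hD with h | h
    · exact h
    exfalso
    have hdis : Disjoint Y D := (Finset.disjoint_iff_inter_eq_empty.2 h).symm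
    have hDS : D ⊆ Sh := by
      obtain ⟨d, hd, y, hy, hdy⟩ := hadj
      exact hIV D hD ⟨d, hd, y, hYS hy, hdy⟩
    have hcard : (Y ∪ D).card = Y.card + D.card := Finset.card_union_of_disjoint hdis
    have hpos := (hCHne D hD).card_pos
    have := hmax (Y ∪ D) (Finset.union_subset hYS hDS) ⟨Finset.mem_union_left _ hwY, ?_, ?_⟩
    · omega
    · intro E hE
      by_cases hED : E = D
      · left
        rw [hED]
        exact Finset.subset_union_right
      · rcases hYII E hE with hE2 | hE2
        · exact Or.inl (hE2.trans Finset.subset_union_left)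
        · right
          rw [← Finset.disjoint_iff_inter_eq_empty] at hE2 ⊢
          exact Finset.disjoint_union_right.2 ⟨hE2, hCHdisj E hE D hD hED⟩
    · have hf : D.filter (fun s => H.degree s ≤ k - 1) = ∅ := by
        apply Finset.filter_eq_empty_iff.2
        intro x hx
        have := hCHdeg D hD x hx
        omega
      rw [Finset.filter_union, hf, Finset.union_empty, hcard]
      have h1 := eBar_union_lt H Y D hadj
      have h2 := hCHe D hD
      have h3 : (eBar H D : ℤ) ≤ ((k : ℤ) - 1) * D.card + 1 := by
        have : ((k - 1 : ℕ) : ℤ) = (k : ℤ) - 1 := by omega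
        rw [← this]
        exact_mod_cast h2
      have h4 : (eBar H (Y ∪ D) : ℤ) + 1 ≤ eBar H Y + eBar H D := by exact_mod_cast h1
      push_cast
      rw [mul_add]
      linarith
  have hYIII : ∀ v ∉ Y, (∃ y ∈ Y, H.Adj v y) → k ≤ (H.neighborFinset v \ Y).card := by
    intro v hv hadj
    by_contra hlt
    have hvS : v ∈ Sh := by
      by_contra hvS
      obtain ⟨y, hy, hvy⟩ := hadj
      have h1 := hIII v hvS ⟨y, hYS hy, hvy⟩
      have h2 := Finset.card_le_card
        (Finset.sdiff_subset_sdiff (Finset.Subset.refl (H.neighborFinset v)) hYS)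
      omega
    have hvD : ∀ D ∈ CH, v ∉ D := by
      intro D hD hvD
      obtain ⟨y, hy, hvy⟩ := hadj
      exact hv (hYIV D hD ⟨v, hvD, y, hy, hvy⟩ hvD)
    have hcard : (insert v Y).card = Y.card + 1 := Finset.card_insert_of_notMem hv
    have := hmax (insert v Y) (Finset.insert_subset hvS hYS)
      ⟨Finset.mem_insert_of_mem hwY, ?_, ?_⟩
    · omega
    · intro E hE
      rcases hYII E hE with hE2 | hE2
      · exact Or.inl (hE2.trans (Finset.subset_insert _ _))
      · right
        rw [← Finset.disjoint_iff_inter_eq_empty] at hE2 ⊢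
        exact Finset.disjoint_insert_right.2 ⟨hvD E hE, hE2⟩
    · have h1 := eBar_insert_le H Y v
      have h4 : (eBar H (insert v Y) : ℤ) ≤ eBar H Y + (H.neighborFinset v \ Y).card := by
        exact_mod_cast h1
      have hdeg : (H.neighborFinset v \ Y).card + 1 ≤ H.degree v := by
        obtain ⟨y, hy, hvy⟩ := hadj
        rw [← SimpleGraph.card_neighborFinset_eq_degree, Nat.succ_le_iff]
        apply Finset.card_lt_card
        refine Finset.ssubset_iff_subset_ne.2 ⟨Finset.sdiff_subset, fun he => ?_⟩
        have hyn : y ∈ H.neighborFinset v := (H.mem_neighborFinset v y).2 hvy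
        rw [← he] at hyn
        exact (Finset.mem_sdiff.1 hyn).2 hy
      rw [Finset.filter_insert, hcard]
      push_cast
      rw [mul_add]
      split_ifs with hd
      · rw [Finset.sum_insert (fun h => hv (Finset.mem_filter.1 h).1)]
        have : ((H.neighborFinset v \ Y).card : ℤ) + 1 ≤ H.degree v := by exact_mod_cast hdeg
        linarith
      · have : ((H.neighborFinset v \ Y).card : ℤ) + 1 ≤ k := by
          have : (H.neighborFinset v \ Y).card + 1 ≤ k := by omega
          exact_mod_cast this
        linarith
  have hEq : Sh = Y := Finset.Subset.antisymm (hShMin Y ⟨hwY, hYII, hYIII, hYIV⟩) hYS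
  rw [hEq]
  exact hYle
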